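/- (Consensus deviation after the primal update of decentralized APDG.) Let A be a d_y × d_x real matrix with ‖A v‖ ≤ L_{xy}‖v‖ for all v ∈ ℝ^{d_x} and ‖Aᵀ w‖ ≤ L_{xy}‖w‖ for all w ∈ ℝ^{d_y}, where L_{xy} > 0. Let η_x > 0, α_x ≥ 0 with η_x α_x ≤ 1, β_x ≥ 0, θ ≥ 0, δ′ ≥ 0, and let X, X_g ∈ ℝ^{d_x×n}, Y_m ∈ ℝ^{d_y×n}, G ∈ ℝ^{d_y×n}, F ∈ ℝ^{d_x×n} satisfy ‖X − X̄‖ ≤ √δ′, ‖X_g − X̄_g‖ ≤ √δ′, and ‖Y_m − Ȳ_m‖ ≤ (1 + 2θ)√δ′, where ‖·‖ is the Frobenius norm, X̄ denotes the matrix each of whose columns equals the average of the columns of X, and A acts column-wise on matrices. Define U = X + η_x α_x (X_g − X) − η_x β_x Aᵀ(A X − G) − η_x (F + Aᵀ Y_m). Then ‖U − Ū‖ ≤ (1 + η_x β_x L_{xy}² + η_x L_{xy}(1 + 2θ)) √δ′ + η_x β_x L_{xy} ‖G‖ + η_x ‖F‖. -/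

import Mathlib

open ContinuousLinearMap
open scoped BigOperators

noncomputable section

/-- Frobenius norm of a matrix given as `n` columns in `ℝ^d`. -/
def fro {d n : ℕ} (M : Fin n → EuclideanSpace ℝ (Fin d)) : ℝ :=
  Real.sqrt (∑ j, ‖M j‖ ^ 2)

/-- The matrix each of whose columns equals the average of the columns of `M`. -/
def colAvg {d n : ℕ} (M : Fin n → EuclideanSpace ℝ (Fin d)) :
    Fin n → EuclideanSpace ℝ (Fin d) :=
  fun _ => (n : ℝ)⁻¹ • ∑ j, M j

/-- Apply a linear map to each column of a matrix. -/
def colMap {d d' n : ℕ} (B : EuclideanSpace ℝ (Fin d) →L[ℝ] EuclideanSpace ℝ (Fin d'))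
    (M : Fin n → EuclideanSpace ℝ (Fin d)) : Fin n → EuclideanSpace ℝ (Fin d') :=
  fun j => B (M j)

theorem fro_eq_norm_toLp {d n : ℕ} (M : Fin n → EuclideanSpace ℝ (Fin d)) :
    fro M = ‖WithLp.toLp 2 M‖ := by
  rw [PiLp.norm_eq_of_L2]
  rfl

theorem fro_nonneg {d n : ℕ} (M : Fin n → EuclideanSpace ℝ (Fin d)) : 0 ≤ fro M :=
  Real.sqrt_nonneg _

theorem fro_add_le {d n : ℕ} (M N : Fin n → EuclideanSpace ℝ (Fin d)) :
    fro (M + N) ≤ fro M + fro N := by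
  simp only [fro_eq_norm_toLp, WithLp.toLp_add]
  exact norm_add_le _ _

theorem fro_sub_le {d n : ℕ} (M N : Fin n → EuclideanSpace ℝ (Fin d)) :
    fro (M - N) ≤ fro M + fro N := by
  simp only [fro_eq_norm_toLp, WithLp.toLp_sub]
  exact norm_sub_le _ _

theorem fro_smul_of_nonneg {d n : ℕ} {c : ℝ} (hc : 0 ≤ c)
    (M : Fin n → EuclideanSpace ℝ (Fin d)) : fro (c • M) = c * fro M := by
  simp only [fro_eq_norm_toLp, WithLp.toLp_smul, norm_smul, Real.norm_of_nonneg hc]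

theorem fro_colMap_le {d d' n : ℕ}
    {B : EuclideanSpace ℝ (Fin d) →L[ℝ] EuclideanSpace ℝ (Fin d')} {L : ℝ} (hL : 0 ≤ L)
    (hB : ∀ v, ‖B v‖ ≤ L * ‖v‖) (M : Fin n → EuclideanSpace ℝ (Fin d)) :
    fro (colMap B M) ≤ L * fro M := by
  refine Real.sqrt_le_iff.mpr ⟨mul_nonneg hL (fro_nonneg M), ?_⟩
  rw [mul_pow, fro, Real.sq_sqrt (Finset.sum_nonneg fun j _ => sq_nonneg _), Finset.mul_sum]
  refine Finset.sum_le_sum fun j _ => ?_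
  rw [← mul_pow]
  exact pow_le_pow_left₀ (norm_nonneg _) (hB (M j)) 2

theorem colAvg_add {d n : ℕ} (M N : Fin n → EuclideanSpace ℝ (Fin d)) :
    colAvg (M + N) = colAvg M + colAvg N := by
  funext j
  simp [colAvg, Finset.sum_add_distrib]

theorem colAvg_sub {d n : ℕ} (M N : Fin n → EuclideanSpace ℝ (Fin d)) :
    colAvg (M - N) = colAvg M - colAvg N := by
  funext j
  simp [colAvg, Finset.sum_sub_distrib, smul_sub]

theorem colAvg_smul {d n : ℕ} (c : ℝ) (M : Fin n → EuclideanSpace ℝ (Fin d)) :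
    colAvg (c • M) = c • colAvg M := by
  funext j
  simp [colAvg, ← Finset.smul_sum, smul_comm c]

theorem colMap_sub {d d' n : ℕ}
    (B : EuclideanSpace ℝ (Fin d) →L[ℝ] EuclideanSpace ℝ (Fin d'))
    (M N : Fin n → EuclideanSpace ℝ (Fin d)) :
    colMap B (M - N) = colMap B M - colMap B N := by
  funext j
  simp [colMap]

theorem colAvg_colMap {d d' n : ℕ}
    (B : EuclideanSpace ℝ (Fin d) →L[ℝ] EuclideanSpace ℝ (Fin d'))
    (M : Fin n → EuclideanSpace ℝ (Fin d)) :
    colAvg (colMap B M) = colMap B (colAvg M) := by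
  funext j
  simp [colAvg, colMap]

/-- Subtracting the average column does not increase the Frobenius norm. -/
theorem fro_sub_colAvg_le {d n : ℕ} (M : Fin n → EuclideanSpace ℝ (Fin d)) :
    fro (M - colAvg M) ≤ fro M := by
  refine Real.sqrt_le_sqrt ?_
  set m : EuclideanSpace ℝ (Fin d) := (n : ℝ)⁻¹ • ∑ j, M j with hm
  have hsum : ∑ j, M j = (n : ℝ) • m := by
    rcases Nat.eq_zero_or_pos n with rfl | hn
    · simp
    · rw [hm, smul_inv_smul₀ (by positivity)]
  have hinner : ∑ j, inner ℝ (M j) m = n * ‖m‖ ^ 2 := by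
    rw [← sum_inner, hsum, real_inner_smul_left, real_inner_self_eq_norm_sq]
  calc ∑ j, ‖(M - colAvg M) j‖ ^ 2
      = ∑ j, (‖M j‖ ^ 2 - 2 * inner ℝ (M j) m + ‖m‖ ^ 2) :=
        Finset.sum_congr rfl fun j _ => norm_sub_sq_real (M j) m
    _ = ∑ j, ‖M j‖ ^ 2 - n * ‖m‖ ^ 2 := by
        rw [Finset.sum_add_distrib, Finset.sum_sub_distrib, ← Finset.mul_sum, hinner]
        simp only [Finset.sum_const, Finset.card_univ, Fintype.card_fin, nsmul_eq_mul]
        ring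
    _ ≤ ∑ j, ‖M j‖ ^ 2 := sub_le_self _ (by positivity)

theorem stmt18 {dx dy n : ℕ}
    (A : EuclideanSpace ℝ (Fin dx) →L[ℝ] EuclideanSpace ℝ (Fin dy))
    (Lxy : ℝ) (hLxy : 0 < Lxy)
    (hA : ∀ v, ‖A v‖ ≤ Lxy * ‖v‖)
    (hAT : ∀ w, ‖adjoint A w‖ ≤ Lxy * ‖w‖)
    (ηx αx βx θ δ' : ℝ) (hηx : 0 < ηx) (hαx : 0 ≤ αx) (hηxαx : ηx * αx ≤ 1)
    (hβx : 0 ≤ βx) (hθ : 0 ≤ θ) (hδ' : 0 ≤ δ')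
    (X Xg F : Fin n → EuclideanSpace ℝ (Fin dx))
    (Ym G : Fin n → EuclideanSpace ℝ (Fin dy))
    (hX : fro (X - colAvg X) ≤ Real.sqrt δ')
    (hXg : fro (Xg - colAvg Xg) ≤ Real.sqrt δ')
    (hYm : fro (Ym - colAvg Ym) ≤ (1 + 2 * θ) * Real.sqrt δ')
    (U : Fin n → EuclideanSpace ℝ (Fin dx))
    (hU : U = X + (ηx * αx) • (Xg - X)
        - (ηx * βx) • colMap (adjoint A) (colMap A X - G)
        - ηx • (F + colMap (adjoint A) Ym)) :
    fro (U - colAvg U)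
      ≤ (1 + ηx * βx * Lxy ^ 2 + ηx * Lxy * (1 + 2 * θ)) * Real.sqrt δ'
        + ηx * βx * Lxy * fro G + ηx * fro F := by
  have hdecomp : U - colAvg U
      = (1 - ηx * αx) • (X - colAvg X) + (ηx * αx) • (Xg - colAvg Xg)
        - (ηx * βx) • (colMap (adjoint A) (colMap A (X - colAvg X))
          - (colMap (adjoint A) G - colAvg (colMap (adjoint A) G)))
        - ηx • ((F - colAvg F) + colMap (adjoint A) (Ym - colAvg Ym)) := by
    simp only [hU, colAvg_add, colAvg_sub, colAvg_smul, colMap_sub, colAvg_colMap]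
    module
  have hηβ : 0 ≤ ηx * βx := by positivity
  have hAX : fro (colMap (adjoint A) (colMap A (X - colAvg X))) ≤ Lxy * (Lxy * √δ') :=
    (fro_colMap_le hLxy.le hAT _).trans (by
      gcongr
      exact (fro_colMap_le hLxy.le hA _).trans (by gcongr))
  have hG : fro (colMap (adjoint A) G - colAvg (colMap (adjoint A) G)) ≤ Lxy * fro G :=
    (fro_sub_colAvg_le _).trans (fro_colMap_le hLxy.le hAT G)
  have hY : fro (colMap (adjoint A) (Ym - colAvg Ym)) ≤ Lxy * ((1 + 2 * θ) * √δ') :=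
    (fro_colMap_le hLxy.le hAT _).trans (by gcongr)
  rw [hdecomp]
  calc _ ≤ (1 - ηx * αx) * fro (X - colAvg X) + ηx * αx * fro (Xg - colAvg Xg)
        + ηx * βx * (fro (colMap (adjoint A) (colMap A (X - colAvg X)))
          + fro (colMap (adjoint A) G - colAvg (colMap (adjoint A) G)))
        + ηx * (fro (F - colAvg F) + fro (colMap (adjoint A) (Ym - colAvg Ym))) := by
        refine (fro_sub_le _ _).trans (add_le_add ((fro_sub_le _ _).trans
          (add_le_add ((fro_add_le _ _).trans (add_le_add ?_ ?_)) ?_)) ?_)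
        · exact (fro_smul_of_nonneg (sub_nonneg.mpr hηxαx) _).le
        · exact (fro_smul_of_nonneg (by positivity) _).le
        · rw [fro_smul_of_nonneg hηβ]
          gcongr
          exact fro_sub_le _ _
        · rw [fro_smul_of_nonneg hηx.le]
          gcongr
          exact fro_add_le _ _
    _ ≤ (1 - ηx * αx) * √δ' + ηx * αx * √δ'
        + ηx * βx * (Lxy * (Lxy * √δ') + Lxy * fro G)
        + ηx * (fro F + Lxy * ((1 + 2 * θ) * √δ')) := by
        have := sub_nonneg.mpr hηxαx
        have := fro_sub_colAvg_le F
        gcongr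
    _ = _ := by ring

end
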